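/- Let N be a finite ground set, 𝒦₀ ⊆ 𝒦 ⊆ 2^N, and let (f, 𝒦) be an incomplete set function with f(∅) = 0. Then for every subadditive monotone extension g of (f, 𝒦) and every S ⊆ N one has f̲ˢᵃᵐ_𝒦(S) ≤ g(S) ≤ f̄ˢᵃᵐ_𝒦(S). -/

import Mathlib

open Finset

/-- The minimal information family: the empty set, the ground set, and all singletons. -/
def K0 (N : Type*) [Fintype N] : Set (Finset N) :=
  {∅, (Finset.univ : Finset N)} ∪ {S : Finset N | ∃ i : N, S = {i}}

/-- A set function is subadditive if `f (S ∪ T) ≤ f S + f T` for disjoint `S`, `T`. -/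
def SubadditiveSF {N : Type*} [DecidableEq N] (f : Finset N → ℝ) : Prop :=
  ∀ S T : Finset N, Disjoint S T → f (S ∪ T) ≤ f S + f T

/-- A set function is monotone if `S ⊆ T` implies `f S ≤ f T`. -/
def MonotoneSF {N : Type*} (f : Finset N → ℝ) : Prop :=
  ∀ S T : Finset N, S ⊆ T → f S ≤ f T

/-- Elementwise monotonicity: `f S ≤ f (S ∪ {i})`. -/
def MonotoneStep {N : Type*} [DecidableEq N] (f : Finset N → ℝ) : Prop :=
  ∀ (S : Finset N) (i : N), i ∉ S → f S ≤ f (insert i S)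

/-- Upper completion: minimum of `∑ f Sᵢ` over families of pairwise disjoint nonempty
sets `Sᵢ ∈ K` partitioning `S`; it is `0` at `∅`. -/
noncomputable def upperC {N : Type*} [DecidableEq N] (f : Finset N → ℝ)
    (K : Set (Finset N)) (S : Finset N) : ℝ :=
  if S = ∅ then 0 else
    sInf {x : ℝ | ∃ P : Finset (Finset N),
      (∀ T ∈ P, T ∈ K) ∧ (∀ T ∈ P, T ≠ ∅) ∧
      (∀ T₁ ∈ P, ∀ T₂ ∈ P, T₁ ≠ T₂ → Disjoint T₁ T₂) ∧
      P.sup id = S ∧ x = ∑ T ∈ P, f T}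

/-- Lower completion: maximum of `f T - upperC f K (T \ S)` over `T ∈ K` with `S ⊆ T`. -/
noncomputable def lowerC {N : Type*} [DecidableEq N] (f : Finset N → ℝ)
    (K : Set (Finset N)) (S : Finset N) : ℝ :=
  sSup {x : ℝ | ∃ T ∈ K, S ⊆ T ∧ x = f T - upperC f K (T \ S)}

/-- The ℓ¹-divergence of `f` with revealed family `K ⊆ 2^N \ K0`. -/
noncomputable def ldiv {N : Type*} [Fintype N] [DecidableEq N] (f : Finset N → ℝ)
    (K : Set (Finset N)) : ℝ :=
  ∑ T : Finset N, (upperC f (K0 N ∪ K) T - lowerC f (K0 N ∪ K) T)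

/-- SAM upper completion: minimum of `∑ f Sᵢ` over nonempty finite families
`S₁, …, S_k ∈ K` covering `S`. -/
noncomputable def samUpper {N : Type*} [DecidableEq N] (f : Finset N → ℝ)
    (K : Set (Finset N)) (S : Finset N) : ℝ :=
  sInf {x : ℝ | ∃ (k : ℕ) (Ss : Fin (k + 1) → Finset N),
    (∀ i, Ss i ∈ K) ∧ S ⊆ Finset.univ.sup Ss ∧ x = ∑ i, f (Ss i)}

/-- SAM lower completion. -/
noncomputable def samLower {N : Type*} [DecidableEq N] (f : Finset N → ℝ)
    (K : Set (Finset N)) (S : Finset N) : ℝ :=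
  max (sSup {x : ℝ | ∃ Y ∈ K, Y ⊆ S ∧ x = f Y})
      (sSup {x : ℝ | ∃ X ∈ K, S ⊆ X ∧ x = f X - samUpper f K (X \ S)})

/-- The SAM ℓ¹-divergence. -/
noncomputable def samDiv {N : Type*} [Fintype N] [DecidableEq N] (f : Finset N → ℝ)
    (K : Set (Finset N)) : ℝ :=
  ∑ T : Finset N, (samUpper f (K0 N ∪ K) T - samLower f (K0 N ∪ K) T)

/-- `{(α i, T i)}` is a fractional cover of `S`. -/
def IsFracCover {N : Type*} [DecidableEq N] (S : Finset N) (k : ℕ)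
    (α : Fin k → ℝ) (T : Fin k → Finset N) : Prop :=
  (∀ i, 0 < α i) ∧
  ∀ j ∈ S, (1 : ℝ) ≤ ∑ i ∈ Finset.univ.filter (fun i => j ∈ T i), α i

/-- A set function is fractionally subadditive. -/
def FracSubadditive {N : Type*} [DecidableEq N] (f : Finset N → ℝ) : Prop :=
  ∀ (S : Finset N) (k : ℕ) (α : Fin k → ℝ) (T : Fin k → Finset N),
    IsFracCover S k α T → f S ≤ ∑ i, α i * f (T i)

/-- XOS: pointwise maximum of finitely many nonnegative additive set functions. -/
def IsXOS {N : Type*} (f : Finset N → ℝ) : Prop :=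
  ∃ (s : ℕ) (a : Fin (s + 1) → N → ℝ),
    (∀ i j, 0 ≤ a i j) ∧
    ∀ S : Finset N, f S = Finset.univ.sup' Finset.univ_nonempty (fun i => ∑ j ∈ S, a i j)

/-- XOS upper completion: infimum of `∑ αᵢ f Tᵢ` over fractional covers of `S`
using sets from `K`. -/
noncomputable def xosUpper {N : Type*} [DecidableEq N] (f : Finset N → ℝ)
    (K : Set (Finset N)) (S : Finset N) : ℝ :=
  sInf {x : ℝ | ∃ (k : ℕ) (α : Fin k → ℝ) (T : Fin k → Finset N),
    IsFracCover S k α T ∧ (∀ i, T i ∈ K) ∧ x = ∑ i, α i * f (T i)}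

/-- Elementwise monotonicity implies monotonicity. -/
theorem MonotoneStep.monotoneSF {N : Type*} [DecidableEq N] {g : Finset N → ℝ}
    (hmono : MonotoneStep g) : MonotoneSF g := by
  have union_le (S U : Finset N) : g S ≤ g (U ∪ S) := by
    induction U using Finset.induction_on with
    | empty => simp
    | insert i U _ ih =>
      rw [Finset.insert_union]
      by_cases hi : i ∈ U ∪ S
      · rwa [Finset.insert_eq_of_mem hi]
      · exact ih.trans (hmono _ i hi)
  intro S T hST
  simpa [Finset.union_eq_left.mpr hST] using union_le S T

/-- For monotone functions, subadditivity extends to unions of sets that may overlap. -/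
theorem SubadditiveSF.union_le {N : Type*} [DecidableEq N] {g : Finset N → ℝ}
    (hg : SubadditiveSF g) (hmono : MonotoneSF g) (S T : Finset N) :
    g (S ∪ T) ≤ g S + g T := by
  have h := hg S (T \ S) Finset.disjoint_sdiff
  rw [Finset.union_sdiff_self_eq_union] at h
  linarith [hmono (T \ S) T Finset.sdiff_subset]

theorem SubadditiveSF.sup_le_sum {N ι : Type*} [DecidableEq N] {g : Finset N → ℝ}
    (hg : SubadditiveSF g) (hmono : MonotoneSF g) (h0 : g ∅ = 0)
    (s : Finset ι) (A : ι → Finset N) : g (s.sup A) ≤ ∑ i ∈ s, g (A i) := by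
  classical
  induction s using Finset.induction_on with
  | empty => simp [h0]
  | insert i s hi ih =>
    rw [Finset.sup_insert, Finset.sum_insert hi]
    exact (hg.union_le hmono _ _).trans (by gcongr)

theorem SubadditiveSF.le_samUpper {N : Type*} [Fintype N] [DecidableEq N]
    {f g : Finset N → ℝ} {K : Set (Finset N)} (huniv : Finset.univ ∈ K)
    (hg : SubadditiveSF g) (hmono : MonotoneSF g) (h0 : g ∅ = 0)
    (hagree : ∀ S ∈ K, g S = f S) (S : Finset N) : g S ≤ samUpper f K S := by
  refine le_csInf ⟨_, 0, fun _ => Finset.univ, fun _ => huniv, by simp, rfl⟩ ?_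
  rintro _ ⟨k, A, hA, hS, rfl⟩
  calc
    g S ≤ g (Finset.univ.sup A) := hmono _ _ hS
    _ ≤ ∑ i, g (A i) := hg.sup_le_sum hmono h0 _ _
    _ = ∑ i, f (A i) := Finset.sum_congr rfl fun i _ => hagree _ (hA i)

/-- every subadditive monotone extension of `(f, K)` lies between the
SAM lower and SAM upper completions. -/
theorem samCompletions_bound_extensions {N : Type*} [Fintype N] [DecidableEq N]
    (f g : Finset N → ℝ) (K : Set (Finset N))
    (hK0 : K0 N ⊆ K) (hf0 : f ∅ = 0)
    (hg : SubadditiveSF g) (hmono : MonotoneStep g)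
    (hagree : ∀ S ∈ K, g S = f S) :
    ∀ S : Finset N, samLower f K S ≤ g S ∧ g S ≤ samUpper f K S := by
  have hempty : ∅ ∈ K := hK0 (by simp [K0])
  have huniv : Finset.univ ∈ K := hK0 (by simp [K0])
  have h0 : g ∅ = 0 := (hagree ∅ hempty).trans hf0
  have hupper := hg.le_samUpper huniv hmono.monotoneSF h0 hagree
  refine fun S => ⟨max_le ?_ ?_, hupper S⟩
  · refine csSup_le ⟨_, ∅, hempty, S.empty_subset, rfl⟩ ?_
    rintro _ ⟨Y, hY, hYS, rfl⟩
    exact (hagree Y hY).symm.trans_le (hmono.monotoneSF _ _ hYS)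
  · refine csSup_le ⟨_, Finset.univ, huniv, S.subset_univ, rfl⟩ ?_
    rintro _ ⟨X, hX, hSX, rfl⟩
    have h := hg S (X \ S) Finset.disjoint_sdiff
    rw [Finset.union_sdiff_of_subset hSX, hagree X hX] at h
    linarith [hupper (X \ S)]
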